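/- arXiv:1004.1918 — 7 statements merged into one kernel-verified Lean document; each statement's English description precedes it below -/
import Mathlib

section
/- Let A and B be abelian categories. The family J of sieves on the product category A^op × B — where a sieve S on an object (X, X') is declared to be covering if and only if S contains a morphism (Y, Y') ⟶ (X, X') of A^op × B determined by a monomorphism f : X ⟶ Y in A and an epimorphism g : Y' ⟶ X' in B — is a Grothendieck topology: the maximal sieve on every object is covering, covering sieves are stable under pullback along arbitrary morphisms, and J satisfies the transitivity (local character) axiom. -/
/-!
STATEMENT 0: Let A and B be abelian categories. The family J of sieves on the product
category A^op × B — where a sieve S on an object (X, X') is declared to be covering if and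
only if S contains a morphism (Y, Y') ⟶ (X, X') of A^op × B determined by a monomorphism
f : X ⟶ Y in A and an epimorphism g : Y' ⟶ X' in B — is a Grothendieck topology: the
maximal sieve on every object is covering, covering sieves are stable under pullback along
arbitrary morphisms, and J satisfies the transitivity (local character) axiom.
-/

open CategoryTheory Limits

universe v₁ v₂ u₁ u₂

variable {A : Type u₁} [Category.{v₁} A] {B : Type u₂} [Category.{v₂} B]

/-- A sieve `S` on an object `(X, X')` of `A^op × B` is covering iff it contains a morphism
`(Y, Y') ⟶ (X, X')` determined by a monomorphism `f : X ⟶ Y` in `A` and an epimorphism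
`g : Y' ⟶ X'` in `B`. -/
def monoEpiCovering (P : Aᵒᵖ × B) (S : Sieve P) : Prop :=
  ∃ (Y : A) (Y' : B) (f : P.1.unop ⟶ Y) (g : Y' ⟶ P.2), Mono f ∧ Epi g ∧
    S.arrows ((f.op, g) : ((Opposite.op Y, Y') : Aᵒᵖ × B) ⟶ P)

/-- The family of covering sieves `monoEpiCovering` on `A^op × B` satisfies the three
axioms of a Grothendieck topology. -/
theorem monoEpiCovering_isGrothendieckTopology [Abelian A] [Abelian B] :
    -- the maximal sieve on every object is covering
    (∀ P : Aᵒᵖ × B, monoEpiCovering P ⊤) ∧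
    -- covering sieves are stable under pullback along arbitrary morphisms
    (∀ ⦃P Q : Aᵒᵖ × B⦄ (h : Q ⟶ P) (S : Sieve P),
      monoEpiCovering P S → monoEpiCovering Q (S.pullback h)) ∧
    -- transitivity (local character)
    (∀ ⦃P : Aᵒᵖ × B⦄ (S : Sieve P), monoEpiCovering P S →
      ∀ (R : Sieve P),
        (∀ ⦃Q : Aᵒᵖ × B⦄ ⦃h : Q ⟶ P⦄, S.arrows h → monoEpiCovering Q (R.pullback h)) →
        monoEpiCovering P R) := by
  refine ⟨fun P => ⟨P.1.unop, P.2, 𝟙 _, 𝟙 _, inferInstance, inferInstance, trivial⟩, ?_, ?_⟩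
  · rintro P Q h S ⟨Y, Y', f, g, hf, hg, hS⟩
    refine ⟨pushout f h.1.unop, pullback g h.2, pushout.inr _ _, pullback.snd _ _,
      inferInstance, inferInstance, ?_⟩
    let k : ((Opposite.op (pushout f h.1.unop), pullback g h.2) : Aᵒᵖ × B) ⟶
        (Opposite.op Y, Y') := ((pushout.inl f h.1.unop).op, pullback.fst g h.2)
    have hk := S.downward_closed hS k
    have e : k ≫ ((f.op, g) : ((Opposite.op Y, Y') : Aᵒᵖ × B) ⟶ P) =
        (((pushout.inr f h.1.unop).op, pullback.snd g h.2) :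
          ((Opposite.op (pushout f h.1.unop), pullback g h.2) : Aᵒᵖ × B) ⟶ Q) ≫ h :=
      Prod.ext (congrArg Quiver.Hom.op (pushout.condition (f := f) (g := h.1.unop)))
        pullback.condition
    rw [e] at hk
    exact hk
  · rintro P S ⟨Y, Y', f, g, hf, hg, hS⟩ R hR
    obtain ⟨Z, Z', f', g', hf', hg', hR'⟩ := hR hS
    exact ⟨Z, Z', f ≫ f', g' ≫ g, mono_comp f f', epi_comp g' g, hR'⟩
end

section
/- Let k be a commutative ring and let A and B be k-linear abelian categories. A presheaf P of k-modules on A^op × B that is k-linear in each variable is a J-sheaf if and only if P is left exact in each variable, i.e.: for every short exact sequence 0 → X → Y → Z → 0 in A and every X' ∈ B the sequence 0 → P(X, X') → P(Y, X') → P(Z, X') of k-modules is exact, and for every X ∈ A and every short exact sequence 0 → Z' → Y' → X' → 0 in B the sequence 0 → P(X, X') → P(X, Y') → P(X, Z') is exact. -/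
/-!
STATEMENT 2: Let k be a commutative ring and let A and B be k-linear abelian categories.
A presheaf P of k-modules on A^op × B that is k-linear in each variable is a J-sheaf if
and only if P is left exact in each variable: for every short exact sequence
0 → X → Y → Z → 0 in A and every X' ∈ B the sequence 0 → P(X, X') → P(Y, X') → P(Z, X')
of k-modules is exact, and for every X ∈ A and every short exact sequence
0 → Z' → Y' → X' → 0 in B the sequence 0 → P(X, X') → P(X, Y') → P(X, Z') is exact.
Here J is the Grothendieck topology on A^op × B in which a sieve on (X, X') is covering
iff it contains a morphism determined by a monomorphism f : X ⟶ Y in A and an epimorphism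
g : Y' ⟶ X' in B.
-/

open CategoryTheory Limits Opposite

universe w v₁ v₂ u u₁ u₂

variable {k : Type u} [CommRing k]
variable {A : Type u₁} [Category.{v₁} A] [Abelian A] [Linear k A]
variable {B : Type u₂} [Category.{v₂} B] [Abelian B] [Linear k B]

/-- The value `P(X, X')` of a presheaf on `A^op × B`, covariant in `X ∈ A` and
contravariant in `X' ∈ B`. -/
abbrev pObj (P : (Aᵒᵖ × B)ᵒᵖ ⥤ ModuleCat.{w} k) (X : A) (X' : B) : ModuleCat.{w} k :=
  P.obj (Opposite.op (Opposite.op X, X'))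

/-- The map `P(X, X') ⟶ P(Y, Y')` induced by `f : X ⟶ Y` in `A` and `g : Y' ⟶ X'`
in `B`. -/
def pMap (P : (Aᵒᵖ × B)ᵒᵖ ⥤ ModuleCat.{w} k) {X Y : A} (f : X ⟶ Y) {X' Y' : B}
    (g : Y' ⟶ X') : pObj P X X' ⟶ pObj P Y Y' :=
  P.map (Quiver.Hom.op ((f.op, g) : ((Opposite.op Y, Y') : Aᵒᵖ × B) ⟶ (Opposite.op X, X')))

section

variable {C : Type u₁} [Category.{v₁} C] {D : Type u₂} [Category.{v₂} D]

lemma pMap_comp (P : (Cᵒᵖ × D)ᵒᵖ ⥤ ModuleCat.{w} k) {X Y Z : C} (f : X ⟶ Y) (f' : Y ⟶ Z)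
    {X' Y' Z' : D} (g : Y' ⟶ X') (g' : Z' ⟶ Y') :
    pMap P f g ≫ pMap P f' g' = pMap P (f ≫ f') (g' ≫ g) :=
  (P.map_comp _ _).symm

lemma pMap_id_comp_pMap_id (P : (Cᵒᵖ × D)ᵒᵖ ⥤ ModuleCat.{w} k) {X Y : C} (f : X ⟶ Y)
    {X' Y' : D} (g : Y' ⟶ X') : pMap P f (𝟙 X') ≫ pMap P (𝟙 Y) g = pMap P f g := by
  simp [pMap_comp]

lemma pMap_id_comp_pMap_id' (P : (Cᵒᵖ × D)ᵒᵖ ⥤ ModuleCat.{w} k) {X Y : C} (f : X ⟶ Y)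
    {X' Y' : D} (g : Y' ⟶ X') : pMap P (𝟙 X) g ≫ pMap P f (𝟙 Y') = pMap P f g := by
  simp [pMap_comp]

/-- A morphism `x` into `P(Y, Y')` descends along `f : X ⟶ Y` and `g : Y' ⟶ X'` if it has the
same restriction along any two morphisms to `(Y, Y')` that agree after composing with `(f, g)`. -/
def IsDescentDatum (P : (Cᵒᵖ × D)ᵒᵖ ⥤ ModuleCat.{w} k) {X Y : C} (f : X ⟶ Y) {X' Y' : D}
    (g : Y' ⟶ X') {E : ModuleCat.{w} k} (x : E ⟶ pObj P Y Y') : Prop :=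
  ∀ ⦃W : C⦄ ⦃W' : D⦄ (a b : Y ⟶ W) (c d : W' ⟶ Y'), f ≫ a = f ≫ b → c ≫ g = d ≫ g →
    x ≫ pMap P a c = x ≫ pMap P b d

lemma isDescentDatum_comp_pMap (P : (Cᵒᵖ × D)ᵒᵖ ⥤ ModuleCat.{w} k) {X Y : C} (f : X ⟶ Y)
    {X' Y' : D} (g : Y' ⟶ X') {E : ModuleCat.{w} k} (t : E ⟶ pObj P X X') :
    IsDescentDatum P f g (t ≫ pMap P f g) := by
  intro W W' a b c d hab hcd
  simp only [Category.assoc, pMap_comp, hab, hcd]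

lemma isSheafFor_singleton_iff_existsUnique (P : (Cᵒᵖ × D)ᵒᵖ ⥤ ModuleCat.{w} k)
    {X Y : C} (f : X ⟶ Y) {X' Y' : D} (g : Y' ⟶ X') (E : ModuleCat.{w} k) :
    Presieve.IsSheafFor (P ⋙ coyoneda.obj (op E))
        (Presieve.singleton ((f.op, g) : ((op Y, Y') : Cᵒᵖ × D) ⟶ (op X, X'))) ↔
      ∀ x : E ⟶ pObj P Y Y', IsDescentDatum P f g x →
        ∃! t : E ⟶ pObj P X X', t ≫ pMap P f g = x := by
  rw [Presieve.isSheafFor_singleton]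
  refine forall_congr' fun x => imp_congr_left ⟨fun h W W' a b c d hab hcd => ?_, ?_⟩
  · exact h ((a.op, c) : ((op W, W') : Cᵒᵖ × D) ⟶ (op Y, Y')) (b.op, d)
      (Prod.ext (congrArg Quiver.Hom.op hab) hcd)
  · rintro h ⟨W, W'⟩ ⟨a, c⟩ ⟨b, d⟩ hp
    exact h a.unop b.unop c d (congrArg Quiver.Hom.unop (congrArg Prod.fst hp))
      (congrArg Prod.snd hp)

lemma isSheaf_iff_existsUnique (J : GrothendieckTopology (Cᵒᵖ × D))
    (hJ : ∀ (Q : Cᵒᵖ × D) (S : Sieve Q), S ∈ J Q ↔ monoEpiCovering Q S)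
    (P : (Cᵒᵖ × D)ᵒᵖ ⥤ ModuleCat.{w} k) :
    Presheaf.IsSheaf J P ↔
      ∀ ⦃X Y : C⦄ (f : X ⟶ Y) ⦃X' Y' : D⦄ (g : Y' ⟶ X'), Mono f → Epi g →
        ∀ (E : ModuleCat.{w} k) (x : E ⟶ pObj P Y Y'), IsDescentDatum P f g x →
          ∃! t : E ⟶ pObj P X X', t ≫ pMap P f g = x := by
  constructor
  · intro h X Y f X' Y' g hf hg E
    rw [← isSheafFor_singleton_iff_existsUnique, Presieve.isSheafFor_iff_generate]
    exact h E _ ((hJ _ _).2 ⟨Y, Y', f, g, hf, hg, Sieve.le_generate _ _ _ ⟨⟩⟩)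
  · intro h E Q S hS
    have hsep : ∀ (R : Cᵒᵖ × D) (T : Sieve R), T ∈ J R →
        Presieve.IsSeparatedFor (P ⋙ coyoneda.obj (op E)) (T : Presieve R) := by
      intro R T hT x t₁ t₂ h₁ h₂
      obtain ⟨Y, Y', f, g, hf, hg, hfg⟩ := (hJ R T).1 hT
      exact (h f g hf hg E _ (isDescentDatum_comp_pMap P f g t₁)).unique rfl
        ((h₂ _ hfg).trans (h₁ _ hfg).symm)
    obtain ⟨Y, Y', f, g, hf, hg, hfg⟩ := (hJ Q S).1 hS
    have hgen : Sieve.generate (Presieve.singleton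
        ((f.op, g) : ((op Y, Y') : Cᵒᵖ × D) ⟶ Q)) ∈ J Q :=
      (hJ _ _).2 ⟨Y, Y', f, g, hf, hg, Sieve.le_generate _ _ _ ⟨⟩⟩
    refine Presieve.isSheafFor_subsieve_aux _ (S := Sieve.generate (Presieve.singleton
        ((f.op, g) : ((op Y, Y') : Cᵒᵖ × D) ⟶ Q))) ?_ ?_ ?_
    · refine (Sieve.generate_le_iff _ _).2 ?_
      rintro _ _ ⟨⟩
      exact hfg
    · rw [← Presieve.isSheafFor_iff_generate]
      exact (isSheafFor_singleton_iff_existsUnique P f g E).2 (h f g hf hg E)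
    · intro R r _
      exact hsep _ _ (J.pullback_stable r hgen)

end

/-- Lifting along the kernel inclusion in an exact sequence `0 → M → N → L` of modules. -/
lemma exists_lift_of_exact {M N L E : ModuleCat.{w} k} (i : M ⟶ N) (p : N ⟶ L)
    (hi : Function.Injective i) (hip : Function.Exact i p) (x : E ⟶ N) (hx : x ≫ p = 0) :
    ∃ t : E ⟶ M, t ≫ i = x := by
  have := (ModuleCat.mono_iff_injective i).2 hi
  let S := ShortComplex.mk i p (by ext m; exact hip.apply_apply_eq_zero m)
  have hS : S.Exact := (ShortComplex.ShortExact.moduleCat_exact_iff_function_exact S).2 hip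
  have : Mono S.f := ‹Mono i›
  exact ⟨hS.lift x hx, hS.lift_f x hx⟩

/-- A morphism of modules with the universal property of a kernel is injective with range the
kernel. -/
lemma injective_and_exact_of_existsUnique_lift {M N L : ModuleCat.{w} k} (i : M ⟶ N) (p : N ⟶ L)
    (hip : i ≫ p = 0) (h : ∀ (E : ModuleCat.{w} k) (x : E ⟶ N), x ≫ p = 0 →
      ∃! t : E ⟶ M, t ≫ i = x) :
    Function.Injective i ∧ Function.Exact i p := by
  constructor
  · rw [← ModuleCat.mono_iff_injective]
    exact ⟨fun a b hab => (h _ (b ≫ i) (by simp [hip])).unique hab rfl⟩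
  · intro y
    constructor
    · intro hy
      obtain ⟨t, ht, -⟩ := h (ModuleCat.of k (LinearMap.ker p.hom))
        (ModuleCat.ofHom (LinearMap.ker p.hom).subtype) (by ext z; exact z.2)
      exact ⟨t ⟨y, hy⟩, ConcreteCategory.congr_hom ht ⟨y, hy⟩⟩
    · rintro ⟨m, rfl⟩
      exact ConcreteCategory.congr_hom hip m

/-- A presheaf of `k`-modules on `A^op × B` which is `k`-linear in each variable is a
sheaf for the topology `J` if and only if it is left exact in each variable. -/
theorem isSheaf_iff_leftExact_in_each_variable
    (J : GrothendieckTopology (Aᵒᵖ × B))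
    (hJ : ∀ (Q : Aᵒᵖ × B) (S : Sieve Q), S ∈ J Q ↔ monoEpiCovering Q S)
    (P : (Aᵒᵖ × B)ᵒᵖ ⥤ ModuleCat.{w} k)
    -- `P` is `k`-linear in the first variable:
    (hadd₁ : ∀ {X Y : A} (f₁ f₂ : X ⟶ Y) (X' : B),
      pMap P (f₁ + f₂) (𝟙 X') = pMap P f₁ (𝟙 X') + pMap P f₂ (𝟙 X'))
    (hsmul₁ : ∀ {X Y : A} (c : k) (f : X ⟶ Y) (X' : B),
      pMap P (c • f) (𝟙 X') = c • pMap P f (𝟙 X'))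
    -- `P` is `k`-linear in the second variable:
    (hadd₂ : ∀ (X : A) {X' Y' : B} (g₁ g₂ : Y' ⟶ X'),
      pMap P (𝟙 X) (g₁ + g₂) = pMap P (𝟙 X) g₁ + pMap P (𝟙 X) g₂)
    (hsmul₂ : ∀ (X : A) {X' Y' : B} (c : k) (g : Y' ⟶ X'),
      pMap P (𝟙 X) (c • g) = c • pMap P (𝟙 X) g) :
    Presheaf.IsSheaf J P ↔
      ((∀ (S : ShortComplex A), S.ShortExact → ∀ (X' : B),
          Function.Injective (pMap P S.f (𝟙 X')) ∧
          Function.Exact (pMap P S.f (𝟙 X')) (pMap P S.g (𝟙 X'))) ∧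
       (∀ (X : A) (S' : ShortComplex B), S'.ShortExact →
          Function.Injective (pMap P (𝟙 X) S'.g) ∧
          Function.Exact (pMap P (𝟙 X) S'.g) (pMap P (𝟙 X) S'.f))) := by
  have hzero₁ : ∀ {X Y : A} (X' : B), pMap P (0 : X ⟶ Y) (𝟙 X') = 0 := by
    intro X Y X'
    simpa using hadd₁ (0 : X ⟶ Y) 0 X'
  have hzero₂ : ∀ (X : A) {X' Y' : B}, pMap P (𝟙 X) (0 : Y' ⟶ X') = 0 := by
    intro X X' Y'
    simpa using hadd₂ X (0 : Y' ⟶ X') 0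
  rw [isSheaf_iff_existsUnique J hJ]
  constructor
  · refine fun h => ⟨fun S hS X' => ?_, fun X S hS => ?_⟩
    · have := hS.mono_f
      have := hS.epi_g
      refine injective_and_exact_of_existsUnique_lift _ _ ?_ fun E x hx =>
        h S.f (𝟙 X') inferInstance inferInstance E x ?_
      · simp [pMap_comp, hzero₁]
      · intro W W' a b c d hab hcd
        obtain rfl : c = d := by simpa using hcd
        obtain ⟨e, he⟩ : ∃ e, S.g ≫ e = a - b :=
          ⟨hS.exact.desc (a - b) (by simp [hab]), hS.exact.g_desc _ _⟩
        rw [← pMap_id_comp_pMap_id P a, ← pMap_id_comp_pMap_id P b, ← sub_add_cancel a b, ← he,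
          hadd₁, ← Category.comp_id (𝟙 X'), ← pMap_comp]
        simp [reassoc_of% hx]
    · have := hS.mono_f
      have := hS.epi_g
      refine injective_and_exact_of_existsUnique_lift _ _ ?_ fun E x hx =>
        h (𝟙 X) S.g inferInstance inferInstance E x ?_
      · simp [pMap_comp, hzero₂]
      · intro W W' a b c d hab hcd
        obtain rfl : a = b := by simpa using hab
        obtain ⟨e, he⟩ : ∃ e, e ≫ S.f = c - d :=
          ⟨hS.exact.lift (c - d) (by simp [hcd]), hS.exact.lift_f _ _⟩
        rw [← pMap_id_comp_pMap_id' P a c, ← pMap_id_comp_pMap_id' P a d, ← sub_add_cancel c d,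
          ← he, hadd₂, ← Category.comp_id (𝟙 X), ← pMap_comp]
        simp [reassoc_of% hx]
  · rintro ⟨h₁, h₂⟩ X Y f X' Y' g hf hg E x hx
    have hS : (ShortComplex.mk f (cokernel.π f) (cokernel.condition f)).ShortExact :=
      { exact := ShortComplex.exact_cokernel f }
    have hS' : (ShortComplex.mk (kernel.ι g) g (kernel.condition g)).ShortExact :=
      { exact := ShortComplex.exact_kernel g }
    obtain ⟨i₁, e₁⟩ := h₁ _ hS X'
    obtain ⟨i₂, e₂⟩ := h₂ Y _ hS'
    have m₁ := (ModuleCat.mono_iff_injective _).2 i₁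
    have m₂ := (ModuleCat.mono_iff_injective _).2 i₂
    have m₃ := (ModuleCat.mono_iff_injective _).2 (h₂ (cokernel f) _ hS').1
    dsimp only at i₁ e₁ i₂ e₂ m₁ m₂ m₃
    obtain ⟨y, rfl⟩ := exists_lift_of_exact _ _ i₂ e₂ x (by
      rw [hx (𝟙 Y) (𝟙 Y) (kernel.ι g) 0 rfl (by simp), hzero₂, comp_zero])
    obtain ⟨t, rfl⟩ := exists_lift_of_exact _ _ i₁ e₁ y (by
      rw [← cancel_mono (pMap P (𝟙 (cokernel f)) g), Category.assoc, pMap_id_comp_pMap_id,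
        ← pMap_id_comp_pMap_id', ← Category.assoc,
        hx (cokernel.π f) 0 (𝟙 Y') (𝟙 Y') (by simp) rfl, hzero₁, comp_zero, zero_comp])
    refine ⟨t, by simp [pMap_id_comp_pMap_id], fun t' ht' => ?_⟩
    simpa only [← pMap_id_comp_pMap_id P f g, ← Category.assoc, cancel_mono] using ht'
end

section
/- Let A and B be abelian categories and let K : A ⥤ D(B) be an additive functor into the derived category of B such that H^n(K(X)) = 0 for every X ∈ A and every integer n < 0, and such that for every i > 0 the functor X ↦ H^i(K(X)) is effaceable. Then for every i > 0, every X ∈ A, every X' ∈ B, and every morphism v : X'[0] ⟶ K(X)[i] in D(B), there exist a monomorphism f : X ⟶ Y in A and an epimorphism g : Y' ⟶ X' in B such that the composite Y'[0] → X'[0] → K(X)[i] → K(Y)[i] (of g[0], v, and K(f)[i]) is zero. -/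
/-!
STATEMENT 4: Let A and B be abelian categories and let K : A ⥤ D(B) be an additive
functor into the derived category of B such that H^n(K(X)) = 0 for every X ∈ A and every
integer n < 0, and such that for every i > 0 the functor X ↦ H^i(K(X)) is effaceable.
Then for every i > 0, every X ∈ A, every X' ∈ B, and every morphism v : X'[0] ⟶ K(X)[i]
in D(B), there exist a monomorphism f : X ⟶ Y in A and an epimorphism g : Y' ⟶ X' in B
such that the composite Y'[0] → X'[0] → K(X)[i] → K(Y)[i] (of g[0], v, and K(f)[i]) is
zero.
-/

open CategoryTheory Limits

universe w v₁ v₂ u₁ u₂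

namespace DerivedCategory

variable {C : Type u₁} [Category.{v₁} C] [Abelian C] [HasDerivedCategory.{w} C]

/-- The cocycles of a complex `K` in degree `n`, placed in degree `n`, map to `K` by a morphism
which is an epimorphism on cohomology in degree `n`. -/
lemma exists_single_hom_epi_homologyFunctor_map (E : DerivedCategory C) (n : ℤ) :
    ∃ (Z : C) (p : (singleFunctor C n).obj Z ⟶ E), Epi ((homologyFunctor C n).map p) := by
  let K := Q.objPreimage E
  let φ : (HomologicalComplex.single C (ComplexShape.up ℤ) n).obj (K.cycles n) ⟶ K :=
    HomologicalComplex.mkHomFromSingle (K.iCycles n) (fun _ _ ↦ K.iCycles_d _ _)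
  have hcycles : (HomologicalComplex.singleObjCyclesSelfIso _ n (K.cycles n)).inv ≫
      HomologicalComplex.cyclesMap φ n = 𝟙 _ := by
    rw [← cancel_mono (K.iCycles n)]
    simp [φ]
  have hepi : Epi (HomologicalComplex.homologyMap φ n) := by
    refine epi_of_epi_fac (f := (HomologicalComplex.singleObjCyclesSelfIso _ n _).inv ≫
      HomologicalComplex.homologyπ _ n) (h := K.homologyπ n) ?_
    rw [Category.assoc, HomologicalComplex.homologyπ_naturality, reassoc_of% hcycles]
  have hQ : Epi ((homologyFunctor C n).map (Q.map φ)) :=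
    ((MorphismProperty.epimorphisms C).arrow_mk_iso_iff
      (((Functor.mapArrowFunctor _ _).mapIso (homologyFunctorFactors C n)).app
        (Arrow.mk φ))).2 hepi
  have hp : Epi ((homologyFunctor C n).map (Q.map φ ≫ (Q.objObjPreimageIso E).hom)) := by
    rw [Functor.map_comp]
    infer_instance
  exact ⟨K.cycles n, Q.map φ ≫ (Q.objObjPreimageIso E).hom, hp⟩

/-- A morphism from a single complex which vanishes on cohomology is killed by precomposition with
an epimorphism. -/
lemma exists_epi_single_map_comp_eq_zero {X : C} {E : DerivedCategory C} (n : ℤ)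
    (w : (singleFunctor C n).obj X ⟶ E) (hw : (homologyFunctor C n).map w = 0) :
    ∃ (Y : C) (g : Y ⟶ X), Epi g ∧ (singleFunctor C n).map g ≫ w = 0 := by
  obtain ⟨F, a, b, hT⟩ := Pretriangulated.distinguished_cocone_triangle₁ w
  have ha : Epi ((homologyFunctor C n).map a) :=
    (HomologySequence.epi_homologyMap_mor₁_iff _ hT n).2 hw
  obtain ⟨Y, p, hp⟩ := exists_single_hom_epi_homologyFunctor_map F n
  obtain ⟨g, hg⟩ := (singleFunctor C n).map_surjective (p ≫ a)
  refine ⟨Y, g, ?_, ?_⟩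
  · refine ((MorphismProperty.epimorphisms C).arrow_mk_iso_iff
      (((Functor.mapArrowFunctor _ _).mapIso (singleFunctorCompHomologyFunctorIso C n)).app
        (Arrow.mk g))).1 ?_
    change Epi ((homologyFunctor C n).map ((singleFunctor C n).map g))
    rw [hg, Functor.map_comp]
    infer_instance
  · have haw : a ≫ w = 0 := Pretriangulated.comp_distTriang_mor_zero₁₂ _ hT
    rw [hg, Category.assoc, haw, comp_zero]

lemma homologyFunctor_map_shift_eq_zero {E F : DerivedCategory C} (f : E ⟶ F) (i n m : ℤ)
    (h : i + n = m) (hf : (homologyFunctor C m).map f = 0) :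
    (homologyFunctor C n).map (f⟦i⟧') = 0 := by
  let e : shiftFunctor (DerivedCategory C) i ⋙ homologyFunctor C n ≅ homologyFunctor C m :=
    (homologyFunctor C 0).shiftIso i n m h
  have : (homologyFunctor C n).map (f⟦i⟧') ≫ e.hom.app F = 0 := by
    have nat := e.hom.naturality f
    rw [hf, comp_zero] at nat
    exact nat
  exact zero_of_comp_mono (e.hom.app F) this

end DerivedCategory

theorem effaceable_cohomology_composite_vanishes
    {A : Type u₁} [Category.{v₁} A] [Abelian A]
    {B : Type u₂} [Category.{v₂} B] [Abelian B] [HasDerivedCategory.{w} B]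
    (K : A ⥤ DerivedCategory B) [K.Additive]
    (hneg : ∀ (X : A) (n : ℤ), n < 0 →
      IsZero ((DerivedCategory.homologyFunctor B n).obj (K.obj X)))
    (heff : ∀ (i : ℤ), 0 < i → ∀ (X : A), ∃ (Y : A) (u : X ⟶ Y), Mono u ∧
      (DerivedCategory.homologyFunctor B i).map (K.map u) = 0)
    (i : ℤ) (hi : 0 < i) (X : A) (X' : B)
    (v : (DerivedCategory.singleFunctor B 0).obj X' ⟶ (K.obj X)⟦i⟧) :
    ∃ (Y : A) (Y' : B) (f : X ⟶ Y) (g : Y' ⟶ X'), Mono f ∧ Epi g ∧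
      (DerivedCategory.singleFunctor B 0).map g ≫ v ≫ (K.map f)⟦i⟧' = 0 := by
  obtain ⟨Y, f, hf, hf₀⟩ := heff i hi X
  have hw : (DerivedCategory.homologyFunctor B 0).map (v ≫ (K.map f)⟦i⟧') = 0 := by
    rw [Functor.map_comp, DerivedCategory.homologyFunctor_map_shift_eq_zero _ i 0 i (by simp) hf₀,
      comp_zero]
  obtain ⟨Y', g, hg, hgw⟩ := DerivedCategory.exists_epi_single_map_comp_eq_zero 0 _ hw
  exact ⟨Y, Y', f, g, hf, hg, hgw⟩
end

section
/- Let C be an abelian category that has countable coproducts and in which countable filtered colimits exist and are exact. For every sequence X⁰ → X¹ → X² → ⋯ of cochain complexes over C, the canonical morphism hocolim Xⁱ ⟶ colim Xⁱ — given in each degree by zero on the shifted first summand of the mapping cone and by the canonical maps to the colimit on the second summand — is a quasi-isomorphism. -/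
/-!
STATEMENT 5: Let C be an abelian category that has countable coproducts and in which
countable filtered colimits exist and are exact. For every sequence X⁰ → X¹ → X² → ⋯ of
cochain complexes over C, the canonical morphism hocolim Xⁱ ⟶ colim Xⁱ — given in each
degree by zero on the shifted first summand of the mapping cone and by the canonical maps
to the colimit on the second summand — is a quasi-isomorphism.
-/

open CategoryTheory Limits CochainComplex HomComplex

universe v u

noncomputable section

variable {C : Type u} [Category.{v} C] [Abelian C] [HasCountableCoproducts C]

/-- The countable coproduct `⊕ᵢ Xⁱ` of the terms of a sequence of cochain complexes. -/
abbrev seqCoprod (X : ℕ ⥤ CochainComplex C ℤ) : CochainComplex C ℤ := ∐ (fun i => X.obj i)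

/-- The morphism `v : ⊕ᵢ Xⁱ ⟶ ⊕ᵢ Xⁱ` whose component on the `i`-th summand is
(the canonical inclusion of `Xⁱ`) minus (the canonical inclusion of `X^{i+1}`) ∘ `φⁱ`. -/
def seqMap (X : ℕ ⥤ CochainComplex C ℤ) : seqCoprod X ⟶ seqCoprod X :=
  Sigma.desc (fun i => Sigma.ι (fun j => X.obj j) i -
    X.map (homOfLE (Nat.le_succ i)) ≫ Sigma.ι (fun j => X.obj j) (i + 1))

/-- The homotopy colimit of a sequence of cochain complexes: the mapping cone of `v`. -/
def seqHocolim (X : ℕ ⥤ CochainComplex C ℤ) : CochainComplex C ℤ := mappingCone (seqMap X)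

/-- The canonical morphism `⊕ᵢ Xⁱ ⟶ colim Xⁱ`. -/
def seqToColim (X : ℕ ⥤ CochainComplex C ℤ) [HasColimitsOfShape ℕ C] :
    seqCoprod X ⟶ colimit X :=
  Sigma.desc (fun i => colimit.ι X i)

lemma seqMap_comp_seqToColim (X : ℕ ⥤ CochainComplex C ℤ) [HasColimitsOfShape ℕ C] :
    seqMap X ≫ seqToColim X = 0 := by
  ext i
  simp [seqMap, seqToColim]

/-- The canonical morphism `hocolim Xⁱ ⟶ colim Xⁱ`, given in each degree by zero on the
shifted first summand of the mapping cone and by the canonical maps to the colimit on the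
second summand. -/
def hocolimToColim (X : ℕ ⥤ CochainComplex C ℤ) [HasColimitsOfShape ℕ C] :
    seqHocolim X ⟶ colimit X :=
  mappingCone.desc (seqMap X) 0 (seqToColim X)
    (by rw [δ_zero, seqMap_comp_seqToColim, Cochain.ofHom_zero])

/-- If colimits of shape `J` in `V` preserve monomorphisms, then so do colimits of shape `J` of
homological complexes in `V`. -/
lemma preservesMonomorphisms_colim_homologicalComplex {V : Type*} [Category* V] [Abelian V]
    {ι : Type*} (c : ComplexShape ι) (J : Type*) [Category* J] [HasColimitsOfShape J V]
    [(colim : (J ⥤ V) ⥤ V).PreservesMonomorphisms] :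
    (colim : (J ⥤ HomologicalComplex V c) ⥤ _).PreservesMonomorphisms where
  preserves {F G} φ _ := HomologicalComplex.mono_of_mono_f _ fun n => by
    let e := HomologicalComplex.eval V c n
    exact colim.map_mono' (Functor.whiskerRight φ e)
      (isColimitOfPreserves e (colimit.isColimit F)) (isColimitOfPreserves e (colimit.isColimit G))
      (e.map (colim.map φ)) fun j => by
        simp [← Functor.map_comp]

/-- A morphism out of a coproduct is a monomorphism as soon as its restrictions to all finite
subcoproducts are, provided filtered colimits indexed by finite subsets preserve monomorphisms. -/
lemma mono_of_mono_comp_finiteSubcoproducts {D : Type*} [Category* D] [HasFiniteCoproducts D]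
    {α : Type*} [HasColimitsOfShape (Finset (Discrete α)) D]
    [(colim : (Finset (Discrete α) ⥤ D) ⥤ D).PreservesMonomorphisms]
    (Y : α → D) [HasCoproduct Y] {Z : D} (f : ∐ Y ⟶ Z)
    (hf : ∀ s : Finset (Discrete α),
      Mono ((Sigma.desc fun x : s => Sigma.ι Y x.1.as) ≫ f)) : Mono f := by
  let S := CoproductsFromFiniteFiltered.finiteSubcoproductsCocone Y
  let φ : CoproductsFromFiniteFiltered.liftToFinsetObj (Discrete.functor Y) ⟶
      (Functor.const _).obj Z := S.ι ≫ (Functor.const _).map f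
  have (s : Finset (Discrete α)) : Mono (φ.app s) := hf s
  have : Mono φ := NatTrans.mono_of_mono_app φ
  have : Nonempty (Finset (Discrete α)) := ⟨∅⟩
  have : IsConnected (Finset (Discrete α)) := IsFiltered.isConnected _
  exact colim.map_mono' φ (CoproductsFromFiniteFiltered.isColimitFiniteSubproductsCocone Y)
    (isColimitConstCocone _ Z) f fun s =>
      (Category.comp_id _).symm

/-- In a preadditive category, a morphism into a finite coproduct is zero if its compositions with
all the projections are. -/
lemma eq_zero_of_comp_sigma_π_eq_zero {D : Type*} [Category* D] [Preadditive D]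
    {β : Type*} [Finite β] [DecidableEq β] (Y : β → D) [HasCoproduct Y] {T : D} (k : T ⟶ ∐ Y)
    (hk : ∀ b, k ≫ Sigma.π Y b = 0) : k = 0 := by
  have := Fintype.ofFinite β
  have h : 𝟙 (∐ Y) = ∑ b, Sigma.π Y b ≫ Sigma.ι Y b := by
    ext b
    rw [Preadditive.comp_sum, Finset.sum_eq_single b] <;> grind [zero_comp]
  rw [← Category.comp_id k, h, Preadditive.comp_sum]
  exact Finset.sum_eq_zero fun b _ => by rw [reassoc_of% hk b, zero_comp]

/-- If the coordinates of a morphism `k` into `⊕ᵢ Yᵢ` satisfy the recursion imposed by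
`k ≫ (1 - shift) = 0`, they all vanish. -/
lemma comp_π_eq_zero_of_comp_one_sub_shift {D : Type*} [Category* D] [Preadditive D]
    (Y : ℕ → D) [HasCoproduct Y] (φ : ∀ i, Y i ⟶ Y (i + 1)) {T : D} (k : T ⟶ ∐ Y)
    (hk : k ≫ Sigma.desc (fun i => Sigma.ι Y i - φ i ≫ Sigma.ι Y (i + 1)) = 0) (i : ℕ) :
    k ≫ Sigma.π Y i = 0 := by
  induction i with
  | zero =>
    have h : Sigma.desc (fun i => Sigma.ι Y i - φ i ≫ Sigma.ι Y (i + 1)) ≫ Sigma.π Y 0 =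
        Sigma.π Y 0 := by
      ext j
      simp [Sigma.ι_π_of_ne]
    rw [← h, reassoc_of% hk, zero_comp]
  | succ i ih =>
    have h : Sigma.desc (fun i => Sigma.ι Y i - φ i ≫ Sigma.ι Y (i + 1)) ≫ Sigma.π Y (i + 1) =
        Sigma.π Y (i + 1) - Sigma.π Y i ≫ φ i := by
      ext j
      obtain rfl | hj := eq_or_ne j i
      · simp
      · simp [Sigma.ι_π_of_ne, Sigma.ι_π_of_ne_assoc, hj]
    have hsucc := hk =≫ Sigma.π Y (i + 1)
    rw [Category.assoc, h, Preadditive.comp_sub, reassoc_of% ih] at hsucc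
    simpa using hsucc

/-- The morphism `1 - shift` on a countable coproduct is a monomorphism if filtered colimits indexed
by finite subsets of `ℕ` preserve monomorphisms. -/
lemma mono_one_sub_shift {D : Type*} [Category* D] [Preadditive D] [HasFiniteCoproducts D]
    [HasColimitsOfShape (Finset (Discrete ℕ)) D]
    [(colim : (Finset (Discrete ℕ) ⥤ D) ⥤ D).PreservesMonomorphisms]
    (Y : ℕ → D) [HasCoproduct Y] (φ : ∀ i, Y i ⟶ Y (i + 1)) :
    Mono (Sigma.desc (fun i => Sigma.ι Y i - φ i ≫ Sigma.ι Y (i + 1))) := by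
  refine mono_of_mono_comp_finiteSubcoproducts Y _ fun s =>
    Preadditive.mono_of_cancel_zero _ fun {T} k hk => ?_
  refine eq_zero_of_comp_sigma_π_eq_zero _ _ fun b => ?_
  have h : (Sigma.desc fun x : s => Sigma.ι Y x.1.as) ≫ Sigma.π Y b.1.as =
      Sigma.π (fun x : s => Y x.1.as) b := by
    ext x
    obtain rfl | hx := eq_or_ne x b
    · simp
    · have : x.1.as ≠ b.1.as := fun h => hx (Subtype.ext (Discrete.ext h))
      simp [Sigma.ι_π_of_ne, hx, this]
  rw [← h, ← Category.assoc]
  exact comp_π_eq_zero_of_comp_one_sub_shift Y φ _ (by simpa using hk) _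

/-- The canonical morphism `⊕ᵢ Xⁱ ⟶ colim Xⁱ` is a cokernel of `seqMap X`. -/
def isColimitSeqToColim (X : ℕ ⥤ CochainComplex C ℤ) [HasColimitsOfShape ℕ C] :
    IsColimit (CokernelCofork.ofπ (seqToColim X) (seqMap_comp_seqToColim X)) :=
  CokernelCofork.IsColimit.ofπ _ _
    (fun {Z} k hk => colimit.desc X ⟨Z, NatTrans.ofSequence
      (fun i => Sigma.ι (fun j => X.obj j) i ≫ k) fun i => by
        have h := Sigma.ι (fun j => X.obj j) i ≫= hk
        rw [seqMap, Sigma.ι_desc_assoc, Preadditive.sub_comp, comp_zero, sub_eq_zero,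
          Category.assoc] at h
        simpa using h.symm⟩)
    (fun k hk => by
      ext i
      simp [seqToColim])
    (fun k hk m hm => by
      refine colimit.hom_ext fun i => ?_
      simp [← hm, seqToColim])

/-- If `C` is an abelian category with countable coproducts in which countable filtered
colimits exist and are exact, then for every sequence of cochain complexes over `C` the
canonical morphism `hocolim Xⁱ ⟶ colim Xⁱ` is a quasi-isomorphism. -/
theorem hocolimToColim_quasiIso
    [HasColimitsOfShape ℕ C]
    (hexists : ∀ (J : Type) [SmallCategory J] [CountableCategory J] [IsFiltered J],
      HasColimitsOfShape J C)
    (hexact : ∀ (J : Type) [SmallCategory J] [CountableCategory J] [IsFiltered J]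
      [HasColimitsOfShape J C], PreservesFiniteLimits (colim (J := J) (C := C)))
    (X : ℕ ⥤ CochainComplex C ℤ) :
    QuasiIso (hocolimToColim X) := by
  have : HasColimitsOfShape (Finset (Discrete ℕ)) C := hexists _
  have := hexact (Finset (Discrete ℕ))
  have := preservesMonomorphisms_colim_homologicalComplex (V := C) (ComplexShape.up ℤ)
    (Finset (Discrete ℕ))
  have : Mono (seqMap X) := mono_one_sub_shift _ _
  have : Epi (seqToColim X) := Cofork.IsColimit.epi (isColimitSeqToColim X)
  exact mappingCone.quasiIso_descShortComplex
    (S := ShortComplex.mk _ _ (seqMap_comp_seqToColim X))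
    { exact := ShortComplex.exact_of_g_is_cokernel _ (isColimitSeqToColim X) }

end
end

section
/- Let C be an abelian category in which countable coproducts exist and are exact. Let (Xⁱ, φⁱ) ⟶ (X′ⁱ, φ′ⁱ) be a morphism of sequences of cochain complexes over C (a family of chain maps Xⁱ → X′ⁱ commuting with the transition maps) such that each chain map Xⁱ → X′ⁱ is a quasi-isomorphism. Then the induced morphism hocolim Xⁱ ⟶ hocolim X′ⁱ is a quasi-isomorphism. -/
/-!
STATEMENT 6: Let C be an abelian category in which countable coproducts exist and are
exact. Let (Xⁱ, φⁱ) ⟶ (X′ⁱ, φ′ⁱ) be a morphism of sequences of cochain complexes over C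
such that each chain map Xⁱ → X′ⁱ is a quasi-isomorphism. Then the induced morphism
hocolim Xⁱ ⟶ hocolim X′ⁱ is a quasi-isomorphism.
-/

open CategoryTheory Limits CochainComplex HomComplex

universe v u

noncomputable section

variable {C : Type u} [Category.{v} C] [Abelian C] [HasCountableCoproducts C]

lemma seqMap_naturality {X Y : ℕ ⥤ CochainComplex C ℤ} (η : X ⟶ Y) :
    seqMap X ≫ Limits.Sigma.map (fun i => η.app i) =
      Limits.Sigma.map (fun i => η.app i) ≫ seqMap Y := by
  apply Limits.Sigma.hom_ext
  intro i
  simp [seqMap, η.naturality]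

/-- The morphism `hocolim Xⁱ ⟶ hocolim X′ⁱ` induced by a morphism of sequences of cochain
complexes. -/
def seqHocolimMap {X Y : ℕ ⥤ CochainComplex C ℤ} (η : X ⟶ Y) :
    seqHocolim X ⟶ seqHocolim Y :=
  mappingCone.map (seqMap X) (seqMap Y)
    (Limits.Sigma.map (fun i => η.app i)) (Limits.Sigma.map (fun i => η.app i))
    (seqMap_naturality η)

namespace HomologicalComplex

variable {D ι J : Type*} [Category* D] [Category* J] {c : ComplexShape ι}

/-- A functor to complexes, seen as a complex of functors. -/
def ofFunctor [HasZeroMorphisms D] (F : J ⥤ HomologicalComplex D c) :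
    HomologicalComplex (J ⥤ D) c where
  X n := F ⋙ eval D c n
  d n m := { app := fun j => (F.obj j).d n m
             naturality := fun _ _ f => (F.map f).comm n m }
  shape n m h := by
    ext j
    exact (F.obj j).shape n m h
  d_comp_d' n m k _ _ := by
    ext j
    exact (F.obj j).d_comp_d n m k

/-- The morphism of complexes of functors attached to a natural transformation of functors
to complexes. -/
def ofFunctorMap [HasZeroMorphisms D] {F G : J ⥤ HomologicalComplex D c} (α : F ⟶ G) :
    ofFunctor F ⟶ ofFunctor G where
  f n := Functor.whiskerRight α (eval D c n)
  comm' n m _ := by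
    ext j
    exact (α.app j).comm n m

variable [Abelian D]

/-- The colimit of a functor to complexes, computed degreewise. -/
def colimitIsoColimOfFunctor [HasColimitsOfShape J D] (F : J ⥤ HomologicalComplex D c) :
    colimit F ≅ ((colim (J := J) (C := D)).mapHomologicalComplex c).obj (ofFunctor F) :=
  colimit.isoColimitCocone ⟨_, isColimitCoconeOfHasColimitEval F⟩

lemma ι_colimitIsoColimOfFunctor_hom_f [HasColimitsOfShape J D]
    (F : J ⥤ HomologicalComplex D c) (j : J) (n : ι) :
    (colimit.ι F j).f n ≫ (colimitIsoColimOfFunctor F).hom.f n =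
      colimit.ι (F ⋙ eval D c n) j := by
  rw [← comp_f]
  exact congr_hom (colimit.isoColimitCocone_ι_hom ⟨_, isColimitCoconeOfHasColimitEval F⟩ j) n

/-- A colimit of quasi-isomorphisms is a quasi-isomorphism when colimits of that shape
are exact. -/
lemma quasiIso_colimMap [HasColimitsOfShape J D]
    [PreservesFiniteLimits (colim (J := J) (C := D))]
    {F G : J ⥤ HomologicalComplex D c} (α : F ⟶ G) (hα : ∀ j, QuasiIso (α.app j)) :
    QuasiIso (colimMap α) := by
  have h : QuasiIso (ofFunctorMap α) := (quasiIso_iff_evaluation _).2 hα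
  refine quasiIso_of_arrow_mk_iso
    (((colim (J := J) (C := D)).mapHomologicalComplex c).map (ofFunctorMap α)) _
    (Arrow.isoMk (colimitIsoColimOfFunctor F).symm (colimitIsoColimOfFunctor G).symm ?_)
  rw [Iso.symm_hom, Iso.symm_hom, Iso.inv_comp_eq, ← Category.assoc, Iso.eq_comp_inv]
  refine colimit.hom_ext fun j => ?_
  ext n
  have hF := ι_colimitIsoColimOfFunctor_hom_f F j n
  have hG := ι_colimitIsoColimOfFunctor_hom_f G j n
  simp only [comp_f, Arrow.mk_hom]
  rw [← comp_f_assoc, ι_colimMap, comp_f_assoc, hG]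
  exact (ι_colimMap (Functor.whiskerRight α (eval D c n)) j).symm.trans
    ((Category.assoc _ _ _).symm.trans
      (congrArg (· ≫ colim.map (Functor.whiskerRight α (eval D c n))) hF)).symm

end HomologicalComplex

/-- Mapping cones preserve quasi-isomorphisms. -/
lemma CochainComplex.mappingCone.quasiIso_map {D : Type*} [Category* D] [Abelian D]
    {K₁ L₁ K₂ L₂ : CochainComplex D ℤ} (φ₁ : K₁ ⟶ L₁) (φ₂ : K₂ ⟶ L₂)
    (a : K₁ ⟶ K₂) (b : L₁ ⟶ L₂) (comm : φ₁ ≫ b = a ≫ φ₂)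
    [QuasiIso a] [QuasiIso b] : QuasiIso (mappingCone.map φ₁ φ₂ a b comm) := by
  let _ := HasDerivedCategory.standard D
  rw [← DerivedCategory.isIso_Q_map_iff_quasiIso]
  exact Pretriangulated.isIso₃_of_isIso₁₂
    (DerivedCategory.Q.mapTriangle.map (mappingCone.triangleMap φ₁ φ₂ a b comm))
    (DerivedCategory.mappingCone_triangle_distinguished φ₁)
    (DerivedCategory.mappingCone_triangle_distinguished φ₂)
    ((DerivedCategory.isIso_Q_map_iff_quasiIso (φ := a)).2 inferInstance)
    ((DerivedCategory.isIso_Q_map_iff_quasiIso (φ := b)).2 inferInstance)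

/-- If countable coproducts exist and are exact in the abelian category `C`, then
a termwise quasi-isomorphism of sequences of cochain complexes induces a
quasi-isomorphism on homotopy colimits. -/
theorem seqHocolimMap_quasiIso
    (hexact : ∀ (α : Type) [Countable α] [HasColimitsOfShape (Discrete α) C],
      PreservesFiniteLimits (colim (J := Discrete α) (C := C)))
    {X Y : ℕ ⥤ CochainComplex C ℤ} (η : X ⟶ Y)
    (hη : ∀ i : ℕ, QuasiIso (η.app i)) :
    QuasiIso (seqHocolimMap η) := by
  have := hexact ℕ
  have : QuasiIso (Limits.Sigma.map fun i => η.app i) :=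
    HomologicalComplex.quasiIso_colimMap
      (Discrete.natTrans (F := Discrete.functor X.obj) (G := Discrete.functor Y.obj)
        fun i => η.app i.as)
      fun j => hη j.as
  exact mappingCone.quasiIso_map _ _ _ _ _

end
end

section
/- Let A be an abelian category in which countable coproducts exist and are exact. Let X be a cochain complex over A and let fᵢ : X ⟶ Yᵢ (i ∈ ℕ) be a countable family of quasi-isomorphisms of cochain complexes over A. Then there exist a cochain complex Y over A, a quasi-isomorphism g : X ⟶ Y, and chain maps hᵢ : Yᵢ ⟶ Y such that hᵢ ∘ fᵢ is chain homotopic to g for every i. (One may take Y to be the mapping cone of the morphism φ : ⊕ᵢ X ⟶ ⊕ᵢ Yᵢ whose i-th component is fᵢ − fᵢ₋₁, with g induced by f₁ followed by the inclusion of Y₁.) -/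
open CategoryTheory Limits

universe v u

namespace HomologicalComplex

variable {A : Type u} [Category.{v} A] {ι α : Type*} {c : ComplexShape ι}

section

variable [HasZeroMorphisms A]

/-- A family of complexes, seen as a complex of functors from a discrete category. -/
@[simps]
def ofFamily (K : α → HomologicalComplex A c) :
    HomologicalComplex (Discrete α ⥤ A) c where
  X n := Discrete.functor fun a => (K a).X n
  d i j := Discrete.natTrans fun a => (K a.as).d i j
  shape i j h := by
    ext a
    exact (K a.as).shape i j h
  d_comp_d' i j k _ _ := by
    ext a
    exact (K a.as).d_comp_d i j k

/-- The morphism between complexes of functors induced by a family of morphisms of complexes. -/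
@[simps]
def ofFamilyMap {K L : α → HomologicalComplex A c} (f : ∀ a, K a ⟶ L a) :
    ofFamily K ⟶ ofFamily L where
  f n := Discrete.natTrans fun a => (f a.as).f n
  comm' i j _ := by
    ext a
    exact (f a.as).comm i j

end

lemma quasiIso_ofFamilyMap [Abelian A] {K L : α → HomologicalComplex A c}
    (f : ∀ a, K a ⟶ L a) (hf : ∀ a, QuasiIso (f a)) : QuasiIso (ofFamilyMap f) := by
  rw [quasiIso_iff_evaluation]
  exact fun a => hf a.as

section

variable [Preadditive A] [HasColimitsOfShape (Discrete α) A]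

/-- The degreewise coproduct of a family of complexes, as a cofan. -/
noncomputable def sigmaCofan (K : α → HomologicalComplex A c) : Cofan K :=
  Cofan.mk ((colim.mapHomologicalComplex c).obj (ofFamily K)) fun a =>
    { f := fun n => colimit.ι (Discrete.functor fun a => (K a).X n) ⟨a⟩
      comm' := fun _ _ _ => colimit.ι_desc _ _ }

/-- The morphism from a term of the degreewise coproduct induced by a family of morphisms. -/
noncomputable def sigmaCofanDesc (K : α → HomologicalComplex A c) {n : ι} {T : A}
    (φ : ∀ a, (K a).X n ⟶ T) : (sigmaCofan K).pt.X n ⟶ T :=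
  Sigma.desc φ

lemma sigmaCofan_inj_f_desc (K : α → HomologicalComplex A c) {n : ι} {T : A}
    (φ : ∀ a, (K a).X n ⟶ T) (a : α) :
    ((sigmaCofan K).inj a).f n ≫ sigmaCofanDesc K φ = φ a :=
  colimit.ι_desc _ _

lemma sigmaCofan_hom_ext (K : α → HomologicalComplex A c) {n : ι} {T : A}
    {φ ψ : (sigmaCofan K).pt.X n ⟶ T}
    (h : ∀ a, ((sigmaCofan K).inj a).f n ≫ φ = ((sigmaCofan K).inj a).f n ≫ ψ) : φ = ψ :=
  Sigma.hom_ext _ _ h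

/-- The degreewise coproduct of a family of complexes is a coproduct. -/
noncomputable def isColimitSigmaCofan (K : α → HomologicalComplex A c) :
    IsColimit (sigmaCofan K) :=
  Cofan.IsColimit.mk _
    (fun s =>
      { f := fun n => sigmaCofanDesc K fun a => (s.inj a).f n
        comm' := fun i j _ => by
          refine sigmaCofan_hom_ext K fun a => ?_
          rw [← Category.assoc, sigmaCofan_inj_f_desc, Hom.comm, Hom.comm_assoc,
            sigmaCofan_inj_f_desc] })
    (fun s a => by
      ext n
      exact sigmaCofan_inj_f_desc K _ a)
    (fun s m hm => by
      ext n
      refine sigmaCofan_hom_ext K fun a => ?_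
      rw [sigmaCofan_inj_f_desc, ← hm a, comp_f])

end

end HomologicalComplex

open HomologicalComplex

/-- If coproducts of shape `α` are exact, the coproduct of a family of quasi-isomorphisms is
a quasi-isomorphism. -/
lemma QuasiIso.sigmaMap {A : Type u} [Category.{v} A] [Abelian A] {ι α : Type*}
    {c : ComplexShape ι} [HasColimitsOfShape (Discrete α) A]
    [PreservesFiniteLimits (colim (J := Discrete α) (C := A))]
    {K L : α → HomologicalComplex A c} (f : ∀ a, K a ⟶ L a) (hf : ∀ a, QuasiIso (f a)) :
    QuasiIso (Limits.Sigma.map f) := by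
  have := quasiIso_ofFamilyMap f hf
  let φ : (sigmaCofan K).pt ⟶ (sigmaCofan L).pt :=
    (colim.mapHomologicalComplex c).map (ofFamilyMap f)
  have hφ : QuasiIso φ := quasiIso_map_of_preservesHomology _ _
  let eK := (coproductIsCoproduct K).coconePointUniqueUpToIso (isColimitSigmaCofan K)
  let eL := (coproductIsCoproduct L).coconePointUniqueUpToIso (isColimitSigmaCofan L)
  have fac : Limits.Sigma.map f = eK.hom ≫ φ ≫ eL.inv := by
    rw [← Category.assoc, Iso.eq_comp_inv]
    refine Sigma.hom_ext _ _ fun a => ?_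
    have hK : Sigma.ι K a ≫ eK.hom = (sigmaCofan K).inj a :=
      IsColimit.comp_coconePointUniqueUpToIso_hom _ _ _
    have hL : Sigma.ι L a ≫ eL.hom = (sigmaCofan L).inj a :=
      IsColimit.comp_coconePointUniqueUpToIso_hom _ _ _
    rw [Sigma.ι_map_assoc, hL, ← Category.assoc, hK]
    ext n
    exact (ι_colimMap ((ofFamilyMap f).f n) ⟨a⟩).symm
  rw [fac]
  infer_instance

/-- Quasi-isomorphisms of cochain complexes satisfy the left Ore condition up to homotopy. -/
lemma CochainComplex.exists_homotopy_comp_quasiIso {A : Type u} [Category.{v} A] [Abelian A]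
    {K L M : CochainComplex A ℤ} (s : K ⟶ L) [hs : QuasiIso s] (p : K ⟶ M) :
    ∃ (N : CochainComplex A ℤ) (t : L ⟶ N) (g : M ⟶ N),
      QuasiIso g ∧ Nonempty (Homotopy (s ≫ t) (p ≫ g)) := by
  let Q := HomotopyCategory.quotient A (ComplexShape.up ℤ)
  let : HasDerivedCategory A := HasDerivedCategory.standard A
  obtain ⟨@⟨N', t, g, hg⟩, fac⟩ := MorphismProperty.RightFraction.exists_leftFraction
    (W := HomotopyCategory.quasiIso A (ComplexShape.up ℤ))
    (.mk (Q.map s) ((HomotopyCategory.quotient_map_mem_quasiIso_iff s).2 hs) (Q.map p))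
  obtain ⟨N, rfl⟩ := HomotopyCategory.quotient_obj_surjective N'
  obtain ⟨t, rfl⟩ := Q.map_surjective t
  obtain ⟨g, rfl⟩ := Q.map_surjective g
  refine ⟨N, t, g, (HomotopyCategory.quotient_map_mem_quasiIso_iff g).1 hg,
    ⟨HomotopyCategory.homotopyOfEq _ _ ?_⟩⟩
  simpa using fac.symm

theorem exists_common_quasiIso_receptacle
    {A : Type u} [Category.{v} A] [Abelian A] [HasCountableCoproducts A]
    (hexact : ∀ (α : Type) [Countable α] [HasColimitsOfShape (Discrete α) A],
      PreservesFiniteLimits (colim (J := Discrete α) (C := A)))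
    (X : CochainComplex A ℤ) (Y : ℕ → CochainComplex A ℤ)
    (f : ∀ i : ℕ, X ⟶ Y i) (hf : ∀ i : ℕ, QuasiIso (f i)) :
    ∃ (Z : CochainComplex A ℤ) (g : X ⟶ Z) (h : ∀ i : ℕ, Y i ⟶ Z),
      QuasiIso g ∧ ∀ i : ℕ, Nonempty (Homotopy (f i ≫ h i) g) := by
  have := hexact ℕ
  have : QuasiIso (Limits.Sigma.map f) := QuasiIso.sigmaMap f hf
  obtain ⟨Z, t, g, hg, ⟨H⟩⟩ := CochainComplex.exists_homotopy_comp_quasiIso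
    (Limits.Sigma.map f) (Sigma.desc fun _ : ℕ => 𝟙 X)
  refine ⟨Z, g, fun i => Sigma.ι Y i ≫ t, hg, fun i => ⟨?_⟩⟩
  exact ((Homotopy.ofEq (by simp)).trans (H.compLeft (Sigma.ι (fun _ : ℕ => X) i))).trans
    (Homotopy.ofEq (by simp))
end

section
/- Let A and B be abelian categories and let Φ : D(A) ⥤ D(B) be a triangulated functor between their derived categories (commuting with the shift and sending distinguished triangles to distinguished triangles). Suppose there exists an integer N such that for every object M of D(A) with H^j(M) = 0 for all j ≤ N, one has H^j(Φ(M)) = 0 for all j ≤ 0. Then for every X ∈ D(A), every object X' of B, and every integer n > N, the canonical truncation morphism τ_{≤ n−1}X → X induces a bijection Hom_{D(B)}(X'[0], Φ(τ_{≤ n−1}X)) ≅ Hom_{D(B)}(X'[0], Φ(X)). -/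
/-!
STATEMENT 14: Let A and B be abelian categories and let Φ : D(A) ⥤ D(B) be a triangulated
functor between their derived categories. Suppose there exists an integer N such that for
every object M of D(A) with H^j(M) = 0 for all j ≤ N, one has H^j(Φ(M)) = 0 for all
j ≤ 0. Then for every X ∈ D(A), every object X' of B, and every integer n > N, the
canonical truncation morphism τ_{≤ n−1}X → X induces a bijection
Hom_{D(B)}(X'[0], Φ(τ_{≤ n−1}X)) ≅ Hom_{D(B)}(X'[0], Φ(X)).

The truncation triangle `τ_{≤ n−1}X → X → τ_{≥ n}X → (τ_{≤ n−1}X)[1]` is encoded as an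
arbitrary distinguished triangle `T` with second object `X`, whose first object has
cohomology only in degrees `< n` and whose third object has cohomology only in degrees
`≥ n`; any such triangle identifies `T.mor₁` with the canonical morphism `τ_{≤ n−1}X → X`.
-/

open CategoryTheory Limits Pretriangulated

universe w w' v₁ v₂ u₁ u₂

/-- An object `W` that is `≤ a` for a t-structure has the same morphisms to the first two objects
of a distinguished triangle whose third object is `≥ b` for some `b > a`. -/
lemma CategoryTheory.Triangulated.TStructure.bijective_comp_mor₁
    {C : Type u₁} [Category.{v₁} C] [Preadditive C] [HasZeroObject C] [HasShift C ℤ]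
    [∀ n : ℤ, (shiftFunctor C n).Additive] [Pretriangulated C]
    (t : Triangulated.TStructure C) (T : Triangle C) (hT : T ∈ distTriang C)
    (W : C) (a b : ℤ) (hab : a < b) (hW : t.IsLE W a) (h₃ : t.IsGE T.obj₃ b) :
    Function.Bijective (fun φ : W ⟶ T.obj₁ => φ ≫ T.mor₁) := by
  constructor
  · intro φ ψ h
    have hd : (φ - ψ) ≫ T.mor₁ = 0 := by
      rw [Preadditive.sub_comp]
      exact sub_eq_zero.2 h
    obtain ⟨g, hg⟩ := Triangle.coyoneda_exact₂ _ (inv_rot_of_distTriang _ hT) (φ - ψ) hd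
    have hs : t.IsGE (T.obj₃⟦(-1 : ℤ)⟧) (b + 1) := t.isGE_shift _ b (-1) (b + 1) (by lia)
    rw [← sub_eq_zero, hg]
    have hz : g = 0 := t.zero_of_isLE_of_isGE g a (b + 1) (by lia) hW hs
    rw [hz]
    exact zero_comp
  · intro ψ
    obtain ⟨φ, hφ⟩ := Triangle.coyoneda_exact₂ _ hT ψ
      (t.zero_of_isLE_of_isGE _ a b hab hW h₃)
    exact ⟨φ, hφ.symm⟩

theorem hom_single_to_triangulated_functor_truncation_bijective
    {A : Type u₁} [Category.{v₁} A] [Abelian A] [HasDerivedCategory.{w} A]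
    {B : Type u₂} [Category.{v₂} B] [Abelian B] [HasDerivedCategory.{w'} B]
    (Φ : DerivedCategory A ⥤ DerivedCategory B) [Φ.CommShift ℤ] [Φ.IsTriangulated]
    (N : ℤ)
    (hN : ∀ (M : DerivedCategory A),
      (∀ j : ℤ, j ≤ N → IsZero ((DerivedCategory.homologyFunctor A j).obj M)) →
      ∀ j : ℤ, j ≤ 0 → IsZero ((DerivedCategory.homologyFunctor B j).obj (Φ.obj M)))
    (X : DerivedCategory A) (X' : B) (n : ℤ) (hn : N < n)
    (T : Triangle (DerivedCategory A)) (hT : T ∈ (distTriang (DerivedCategory A)))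
    (hTX : T.obj₂ = X)
    (h₁ : ∀ j : ℤ, n ≤ j → IsZero ((DerivedCategory.homologyFunctor A j).obj T.obj₁))
    (h₃ : ∀ j : ℤ, j < n → IsZero ((DerivedCategory.homologyFunctor A j).obj T.obj₃)) :
    Function.Bijective
      (fun (φ : (DerivedCategory.singleFunctor B 0).obj X' ⟶ Φ.obj T.obj₁) =>
        φ ≫ Φ.map T.mor₁) := by
  have hΦ : (Φ.obj T.obj₃).IsGE 1 := by
    rw [DerivedCategory.isGE_iff]
    intro i hi
    exact hN _ (fun j hj => h₃ j (by lia)) i (by lia)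
  exact DerivedCategory.TStructure.t.bijective_comp_mor₁ (Φ.mapTriangle.obj T)
    (Φ.map_distinguished T hT) _ 0 1 (by lia) inferInstance hΦ
end
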